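/- arXiv:1503.08652 — 6 statements merged into one kernel-verified Lean document; each statement's English description precedes it below -/
import Mathlib

section
/- Suppose Y_LL is invertible and each corresponding row of the admittance matrix sums to zero, i.e. for every i ∈ {1,…,n} one has Σ_{j=1}^{m} (Y_LG)_{ij} + Σ_{j=1}^{n} (Y_LL)_{ij} = 0. Then every row of F_LG sums to one: for every i ∈ {1,…,n}, Σ_{j=1}^{m} (F_LG)_{ij} = 1. -/
/-- If `Y_LL` is invertible and every row of the admittance block `[Y_LG Y_LL]`
sums to zero, then every row of `F_LG = -Y_LL⁻¹ * Y_LG` sums to one. -/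
theorem FLG_row_sum_one {n m : ℕ} (hn : 0 < n) (hm : 0 < m)
    (Y_LL : Matrix (Fin n) (Fin n) ℂ) (Y_LG : Matrix (Fin n) (Fin m) ℂ)
    (hYLL : IsUnit Y_LL.det)
    (hrow : ∀ i : Fin n, (∑ j : Fin m, Y_LG i j) + (∑ j : Fin n, Y_LL i j) = 0) :
    ∀ i : Fin n, ∑ j : Fin m, (-(Y_LL⁻¹ * Y_LG)) i j = 1 := by
  intro i
  have h1 : Y_LG.mulVec (fun _ => (1 : ℂ)) = -(Y_LL.mulVec (fun _ => (1 : ℂ))) := by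
    funext k
    have hk := eq_neg_of_add_eq_zero_left (hrow k)
    simpa [Matrix.mulVec, dotProduct] using hk
  have h2 : (-(Y_LL⁻¹ * Y_LG)).mulVec (fun _ => (1 : ℂ)) = fun _ => (1 : ℂ) := by
    rw [Matrix.neg_mulVec, ← Matrix.mulVec_mulVec, h1, Matrix.mulVec_neg, neg_neg,
      Matrix.mulVec_mulVec, Matrix.nonsing_inv_mul _ hYLL, Matrix.one_mulVec]
  have h3 := congrFun h2 i
  simpa only [Matrix.mulVec, dotProduct, mul_one] using h3
end

section
/- Suppose Y_LL is invertible and let ε ∈ ℂ^{n} be the vector of row sums of the admittance blocks, i.e. ε_i = Σ_{j=1}^{m} (Y_LG)_{ij} + Σ_{j=1}^{n} (Y_LL)_{ij} for every i ∈ {1,…,n}. Then the deviation of the row sums of F_LG from one is given exactly by (Σ_{j=1}^{m} (F_LG)_{ij}) − 1 = −(Y_LL⁻¹ · ε)_i for every i ∈ {1,…,n}; in particular the row sums of F_LG are close to one whenever the rows of Y_bus sum close to zero. -/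
/-- If `Y_LL` is invertible and `ε` is the vector of row sums of `[Y_LG Y_LL]`,
then the deviation of the row sums of `F_LG = -Y_LL⁻¹ * Y_LG` from one is
exactly `-(Y_LL⁻¹ ε)`. -/
theorem FLG_row_sum_deviation {n m : ℕ} (hn : 0 < n) (hm : 0 < m)
    (Y_LL : Matrix (Fin n) (Fin n) ℂ) (Y_LG : Matrix (Fin n) (Fin m) ℂ)
    (hYLL : IsUnit Y_LL.det)
    (ε : Fin n → ℂ)
    (hε : ∀ i : Fin n, ε i = (∑ j : Fin m, Y_LG i j) + (∑ j : Fin n, Y_LL i j)) :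
    ∀ i : Fin n, (∑ j : Fin m, (-(Y_LL⁻¹ * Y_LG)) i j) - 1 = -(Y_LL⁻¹.mulVec ε) i := by
  intro i
  have he : ε = Y_LG.mulVec (fun _ => 1) + Y_LL.mulVec (fun _ => 1) := by
    funext k
    simp [hε, Matrix.mulVec, dotProduct]
  have h1 : Y_LL⁻¹.mulVec ε = (Y_LL⁻¹ * Y_LG).mulVec (fun _ => 1) + (fun _ => 1) := by
    rw [he, Matrix.mulVec_add, Matrix.mulVec_mulVec, Matrix.mulVec_mulVec,
      Matrix.nonsing_inv_mul _ hYLL, Matrix.one_mulVec]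
  have h2 : (Y_LL⁻¹ * Y_LG).mulVec (fun _ => 1) i = ∑ j : Fin m, (Y_LL⁻¹ * Y_LG) i j := by
    simp only [Matrix.mulVec, dotProduct, mul_one]
  rw [h1, Pi.add_apply, h2]
  simp only [Matrix.neg_apply, Finset.sum_neg_distrib]
  ring
end

section
/- Suppose Y_LL is invertible and the equal row ratio condition holds. Then every entry of F_LG is a real number, i.e. Im((F_LG)_{ij}) = 0 for all i ∈ {1,…,n} and j ∈ {1,…,m}. -/
/-- If `Y_LL` is invertible and the equal row ratio condition holds (each row of
`[Y_LG Y_LL]` has a common imaginary:real ratio), then every entry of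
`F_LG = -Y_LL⁻¹ * Y_LG` is real. -/
theorem FLG_entries_real {n m : ℕ} (hn : 0 < n) (hm : 0 < m)
    (Y_LL : Matrix (Fin n) (Fin n) ℂ) (Y_LG : Matrix (Fin n) (Fin m) ℂ)
    (hYLL : IsUnit Y_LL.det)
    (hratio : ∀ k : Fin n, ∃ u : ℝ,
      (∀ j : Fin n, (Y_LL k j).im = u * (Y_LL k j).re) ∧
      (∀ j : Fin m, (Y_LG k j).im = u * (Y_LG k j).re)) :
    ∀ (i : Fin n) (j : Fin m), ((-(Y_LL⁻¹ * Y_LG)) i j).im = 0 := by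
  intro i l
  have hX : Y_LL * (Y_LL⁻¹ * Y_LG) = Y_LG := Matrix.mul_nonsing_inv_cancel_left _ _ hYLL
  generalize Y_LL⁻¹ * Y_LG = X at hX ⊢
  have hv : Y_LL.mulVec (fun j => (((X j l).im : ℝ) : ℂ)) = 0 := by
    funext k
    obtain ⟨u, hu, hg⟩ := hratio k
    have hd : (1 + (u : ℂ) * Complex.I) ≠ 0 := by
      intro h
      have := congrArg Complex.re h
      simp at this
    have hY : ∀ j, Y_LL k j = (1 + (u : ℂ) * Complex.I) * ((Y_LL k j).re : ℂ) := by
      intro j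
      apply Complex.ext <;> simp [hu j]
    have hG : Y_LG k l = (1 + (u : ℂ) * Complex.I) * ((Y_LG k l).re : ℂ) := by
      apply Complex.ext <;> simp [hg l]
    have h1 : ∑ j, Y_LL k j * X j l = Y_LG k l := by
      rw [← Matrix.mul_apply, hX]
    have h2 : ∑ j, ((Y_LL k j).re : ℂ) * X j l = ((Y_LG k l).re : ℂ) := by
      apply mul_left_cancel₀ hd
      rw [← hG, ← h1, Finset.mul_sum]
      refine Finset.sum_congr rfl fun j _ => ?_
      rw [← mul_assoc, ← hY j]
    have h3 : ∑ j, (Y_LL k j).re * (X j l).im = 0 := by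
      have := congrArg Complex.im h2
      simpa using this
    have h4 : ∑ j, Y_LL k j * (((X j l).im : ℝ) : ℂ)
        = (1 + (u : ℂ) * Complex.I) * ((∑ j, (Y_LL k j).re * (X j l).im : ℝ) : ℂ) := by
      push_cast
      rw [Finset.mul_sum]
      refine Finset.sum_congr rfl fun j _ => ?_
      rw [← mul_assoc, ← hY j]
    change ∑ j, Y_LL k j * (((X j l).im : ℝ) : ℂ) = 0
    rw [h4, h3]
    simp
  have h0 := Matrix.eq_zero_of_mulVec_eq_zero hYLL.ne_zero hv
  have := congrFun h0 i
  simpa using this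
end

section
/- Suppose Y_LL is invertible and the equal row ratio condition holds. Then the real matrix Re(Y_LL) ∈ ℝ^{n×n} whose entries are the real parts of the entries of Y_LL is invertible. -/
/-- If `Y_LL` is invertible and the equal row ratio condition holds, then the
real matrix of real parts of `Y_LL` is invertible. -/
theorem re_YLL_invertible {n m : ℕ} (hn : 0 < n) (hm : 0 < m)
    (Y_LL : Matrix (Fin n) (Fin n) ℂ) (Y_LG : Matrix (Fin n) (Fin m) ℂ)
    (hYLL : IsUnit Y_LL.det)
    (hratio : ∀ k : Fin n, ∃ u : ℝ,
      (∀ j : Fin n, (Y_LL k j).im = u * (Y_LL k j).re) ∧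
      (∀ j : Fin m, (Y_LG k j).im = u * (Y_LG k j).re)) :
    IsUnit (Y_LL.map Complex.re).det := by
  choose u hu _ using hratio
  have key : Y_LL = Matrix.diagonal (fun k => (1 + (u k : ℂ) * Complex.I)) *
      (Y_LL.map Complex.re).map Complex.ofRealHom := by
    ext k j
    rw [Matrix.diagonal_mul]
    apply Complex.ext <;> simp [hu k j]
  rw [isUnit_iff_ne_zero] at hYLL ⊢
  intro h0
  apply hYLL
  have hmap : ((Y_LL.map Complex.re).map Complex.ofRealHom).det = 0 := by
    have := RingHom.map_det Complex.ofRealHom (Y_LL.map Complex.re)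
    rw [h0, map_zero] at this
    exact this.symm
  rw [key, Matrix.det_mul, hmap, mul_zero]
end

section
/- Suppose Y_LL is invertible and the equal row ratio condition holds. Let Re(Y_LL) ∈ ℝ^{n×n} and Re(Y_LG) ∈ ℝ^{n×m} denote the matrices of entrywise real parts of Y_LL and Y_LG. Then F_LG satisfies the real linear system: the entrywise real part of F_LG, as a matrix in ℝ^{n×m}, satisfies Re(Y_LL) · Re(F_LG) = −Re(Y_LG); equivalently, F_LG equals the complexification of −Re(Y_LL)⁻¹ · Re(Y_LG). -/
/-- If `Y_LL` is invertible and the equal row ratio condition holds, then the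
entrywise real part of `F_LG = -Y_LL⁻¹ * Y_LG` satisfies the real linear system
`Re(Y_LL) * Re(F_LG) = -Re(Y_LG)`; equivalently, `F_LG` is the complexification
of `-Re(Y_LL)⁻¹ * Re(Y_LG)`. -/
theorem FLG_real_linear_system {n m : ℕ} (hn : 0 < n) (hm : 0 < m)
    (Y_LL : Matrix (Fin n) (Fin n) ℂ) (Y_LG : Matrix (Fin n) (Fin m) ℂ)
    (hYLL : IsUnit Y_LL.det)
    (hratio : ∀ k : Fin n, ∃ u : ℝ,
      (∀ j : Fin n, (Y_LL k j).im = u * (Y_LL k j).re) ∧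
      (∀ j : Fin m, (Y_LG k j).im = u * (Y_LG k j).re)) :
    (Y_LL.map Complex.re) * ((-(Y_LL⁻¹ * Y_LG)).map Complex.re) =
      -(Y_LG.map Complex.re) ∧
    -(Y_LL⁻¹ * Y_LG) =
      (-(Y_LL.map Complex.re)⁻¹ * (Y_LG.map Complex.re)).map
        (fun x : ℝ => (x : ℂ)) := by
  choose u hu hv using hratio
  set A := Y_LL.map Complex.re with hA
  set B := Y_LG.map Complex.re with hB
  set D : Matrix (Fin n) (Fin n) ℂ := Matrix.diagonal (fun k => 1 + (u k : ℂ) * Complex.I) with hD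
  have h1 : Y_LL = D * A.map Complex.ofRealHom := by
    ext k j
    rw [hD, Matrix.diagonal_mul]
    apply Complex.ext <;> simp [hA, hu k j]
  have h2 : Y_LG = D * B.map Complex.ofRealHom := by
    ext k j
    rw [hD, Matrix.diagonal_mul]
    apply Complex.ext <;> simp [hB, hv k j]
  have hdet : IsUnit A.det := by
    rw [isUnit_iff_ne_zero] at hYLL ⊢
    intro h0
    apply hYLL
    have h3 : (A.map Complex.ofRealHom).det = 0 := by
      have h4 := RingHom.map_det Complex.ofRealHom A
      rw [h0, map_zero] at h4
      exact h4.symm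
    rw [h1, Matrix.det_mul, h3, mul_zero]
  have hX : A * (-A⁻¹ * B) = -B := by
    rw [Matrix.neg_mul, Matrix.mul_neg, Matrix.mul_nonsing_inv_cancel_left _ _ hdet]
  have hY : Y_LL * (-A⁻¹ * B).map Complex.ofRealHom = -Y_LG := by
    calc Y_LL * (-A⁻¹ * B).map Complex.ofRealHom
        = D * (A.map Complex.ofRealHom * (-A⁻¹ * B).map Complex.ofRealHom) := by
          rw [← Matrix.mul_assoc, ← h1]
      _ = D * (-B).map Complex.ofRealHom := by rw [← Matrix.map_mul, hX]
      _ = -(D * B.map Complex.ofRealHom) := by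
          rw [← Matrix.mul_neg]
          congr 1
          ext i j
          simp
      _ = -Y_LG := by rw [← h2]
  have hF : -(Y_LL⁻¹ * Y_LG) = (-A⁻¹ * B).map Complex.ofRealHom := by
    rw [← Matrix.mul_neg, ← hY, Matrix.nonsing_inv_mul_cancel_left _ _ hYLL]
  refine ⟨?_, hF⟩
  have hR : (-(Y_LL⁻¹ * Y_LG)).map Complex.re = -A⁻¹ * B := by
    rw [hF]
    ext i j
    simp only [Matrix.map_apply, Complex.ofRealHom_eq_coe, Complex.ofReal_re]
  rw [hR, hX]
end

section
/- Suppose Y_LL is invertible, the equal row ratio condition holds, every entry of the real matrix Re(Y_LG) (the entrywise real part of Y_LG) is nonpositive, the real matrix Re(Y_LL) (the entrywise real part of Y_LL) is invertible, and every entry of Re(Y_LL)⁻¹ is nonnegative. Then every entry of F_LG is a nonnegative real number: for all i ∈ {1,…,n} and j ∈ {1,…,m}, Im((F_LG)_{ij}) = 0 and Re((F_LG)_{ij}) ≥ 0. -/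
/-- If `Y_LL` is invertible, the equal row ratio condition holds, every entry of
`Re(Y_LG)` is nonpositive, `Re(Y_LL)` is invertible and every entry of
`Re(Y_LL)⁻¹` is nonnegative, then every entry of `F_LG = -Y_LL⁻¹ * Y_LG` is a
nonnegative real number. -/
theorem FLG_entries_nonneg_real {n m : ℕ} (hn : 0 < n) (hm : 0 < m)
    (Y_LL : Matrix (Fin n) (Fin n) ℂ) (Y_LG : Matrix (Fin n) (Fin m) ℂ)
    (hYLL : IsUnit Y_LL.det)
    (hratio : ∀ k : Fin n, ∃ u : ℝ,
      (∀ j : Fin n, (Y_LL k j).im = u * (Y_LL k j).re) ∧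
      (∀ j : Fin m, (Y_LG k j).im = u * (Y_LG k j).re))
    (hreLG : ∀ (i : Fin n) (j : Fin m), (Y_LG i j).re ≤ 0)
    (hreLL : IsUnit (Y_LL.map Complex.re).det)
    (hreLLinv : ∀ i j : Fin n, 0 ≤ (Y_LL.map Complex.re)⁻¹ i j) :
    ∀ (i : Fin n) (j : Fin m),
      ((-(Y_LL⁻¹ * Y_LG)) i j).im = 0 ∧ 0 ≤ ((-(Y_LL⁻¹ * Y_LG)) i j).re := by
  choose u hu hv using hratio
  set A := Y_LL.map Complex.re with hA
  set X : Matrix (Fin n) (Fin m) ℝ := A⁻¹ * Y_LG.map Complex.re with hX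
  have hAX : A * X = Y_LG.map Complex.re := Matrix.mul_nonsing_inv_cancel_left A _ hreLL
  have hAX' : ∀ k j, ∑ l, (Y_LL k l).re * X l j = (Y_LG k j).re := by
    intro k j
    have h := congrFun (congrFun hAX k) j
    simpa [Matrix.mul_apply, hA] using h
  have key : Y_LL * X.map Complex.ofReal = Y_LG := by
    ext k j
    apply Complex.ext
    · simp [Matrix.mul_apply, hAX']
    · simp only [Matrix.mul_apply, Matrix.map_apply, Complex.im_sum, Complex.mul_im,
        Complex.ofReal_re, Complex.ofReal_im, mul_zero, zero_add, hu, hv]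
      rw [← hAX' k j, Finset.mul_sum]
      exact Finset.sum_congr rfl fun l _ => by ring
  have hF : Y_LL⁻¹ * Y_LG = X.map Complex.ofReal := by
    rw [← key]
    exact Matrix.nonsing_inv_mul_cancel_left Y_LL _ hYLL
  intro i j
  rw [hF]
  have hneg : X i j ≤ 0 := by
    rw [hX, Matrix.mul_apply]
    exact Finset.sum_nonpos fun l _ =>
      mul_nonpos_of_nonneg_of_nonpos (hreLLinv i l) (hreLG l j)
  constructor
  · simp
  · simpa using hneg
end
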